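/- arXiv:2110.03268 — 5 statements merged into one kernel-verified Lean document; each statement's English description precedes it below -/
import Mathlib

section
/- Let Γ be a finite group and let x ∈ Γ have order n = 2^t · m with m odd and t ≥ 2. Then [x] = x^m·[x²] ∪ x^{3m}·[x²], where for a ∈ Γ and A ⊆ Γ, a·A = {a·s : s ∈ A}. -/
noncomputable section

/-- `[x] = {y : ⟨y⟩ = ⟨x⟩}`. -/
def atom1 {Γ : Type*} [Group Γ] (x : Γ) : Set Γ :=
  {y | Subgroup.zpowers y = Subgroup.zpowers x}

theorem zpowers_zpow_eq_zpowers_iff {G : Type*} [Group G] (g : G) (k : ℤ) :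
    Subgroup.zpowers (g ^ k) = Subgroup.zpowers g ↔ IsCoprime k (orderOf g : ℤ) := by
  constructor
  · intro h
    have hg : g ∈ Subgroup.zpowers (g ^ k) := h ▸ Subgroup.mem_zpowers g
    obtain ⟨a, ha⟩ := Subgroup.mem_zpowers_iff.mp hg
    have h1 : g ^ (1 - k * a) = 1 := by
      rw [zpow_sub, zpow_one, zpow_mul, ha, mul_inv_cancel]
    obtain ⟨b, hb⟩ := orderOf_dvd_iff_zpow_eq_one.mpr h1
    exact ⟨a, b, by linarith⟩
  · rintro ⟨a, b, hab⟩
    refine le_antisymm (Subgroup.zpowers_le.mpr (Subgroup.zpow_mem_zpowers g k))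
      (Subgroup.zpowers_le.mpr (Subgroup.mem_zpowers_iff.mpr ⟨a, ?_⟩))
    rw [← zpow_mul, show k * a = 1 - orderOf g * b by linarith, zpow_sub, zpow_mul,
      zpow_natCast, pow_orderOf_eq_one]
    simp

theorem mem_atom1_iff {G : Type*} [Group G] (x y : G) :
    y ∈ atom1 x ↔ ∃ k : ℤ, IsCoprime k (orderOf x : ℤ) ∧ x ^ k = y := by
  constructor
  · intro h
    have hy : y ∈ Subgroup.zpowers x := by
      rw [← show Subgroup.zpowers y = Subgroup.zpowers x from h]
      exact Subgroup.mem_zpowers y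
    obtain ⟨k, rfl⟩ := Subgroup.mem_zpowers_iff.mp hy
    exact ⟨k, (zpowers_zpow_eq_zpowers_iff x k).mp h, rfl⟩
  · rintro ⟨k, hk, rfl⟩
    exact (zpowers_zpow_eq_zpowers_iff x k).mpr hk

theorem Int.isCoprime_two_pow_mul_iff {t : ℕ} (ht : 0 < t) (k m : ℤ) :
    IsCoprime k (2 ^ t * m) ↔ Odd k ∧ IsCoprime k m := by
  rw [IsCoprime.mul_right_iff, IsCoprime.pow_right_iff ht, Int.isCoprime_iff_gcd_eq_one,
    Int.gcd_comm, ← Int.isCoprime_iff_gcd_eq_one, Int.isCoprime_two_left]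

theorem Int.isCoprime_mul_add_two_mul_iff {m : ℤ} (hm : Odd m) (c j : ℤ) :
    IsCoprime (c * m + 2 * j) m ↔ IsCoprime j m := by
  rw [add_comm, IsCoprime.add_mul_right_left_iff, IsCoprime.mul_left_iff,
    Int.isCoprime_two_left, and_iff_right hm]

/-- If `x` has order `n = 2^t·m` with `m` odd and `t ≥ 2`, then
`[x] = x^m·[x²] ∪ x^{3m}·[x²]`. -/
theorem atom1_eq_union_translates
    (Γ : Type*) [Group Γ] [Fintype Γ] (x : Γ) (t m : ℕ)
    (hord : orderOf x = 2 ^ t * m) (hm : Odd m) (ht : 2 ≤ t) :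
    atom1 x = (fun s => x ^ m * s) '' atom1 (x ^ 2)
      ∪ (fun s => x ^ (3 * m) * s) '' atom1 (x ^ 2) := by
  have hx : (orderOf x : ℤ) = 2 ^ t * m := by exact_mod_cast hord
  have hx2 : (orderOf (x ^ 2) : ℤ) = 2 ^ (t - 1) * m := by
    obtain ⟨s, rfl⟩ : ∃ s, t = s + 1 := ⟨t - 1, by omega⟩
    rw [orderOf_pow_of_dvd two_ne_zero ⟨2 ^ s * m, by rw [hord]; ring⟩, hord,
      show 2 ^ (s + 1) * m = 2 ^ s * m * 2 by ring, Nat.mul_div_cancel _ two_pos]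
    simp
  have hm' : Odd (m : ℤ) := by exact_mod_cast hm
  have htrans (c : ℕ) (j : ℤ) : x ^ (c * m) * (x ^ 2) ^ j = x ^ ((c : ℤ) * m + 2 * j) := by
    rw [zpow_add, zpow_mul x 2 j]
    norm_cast
  have hcop (c : ℕ) (hc : Odd (c : ℤ)) (j : ℤ) (hj : IsCoprime j (orderOf (x ^ 2) : ℤ)) :
      x ^ (c * m) * (x ^ 2) ^ j ∈ atom1 x := by
    rw [hx2, Int.isCoprime_two_pow_mul_iff (by omega)] at hj
    refine (mem_atom1_iff _ _).mpr ⟨c * m + 2 * j, ?_, (htrans c j).symm⟩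
    rw [hx, Int.isCoprime_two_pow_mul_iff (by omega), Int.isCoprime_mul_add_two_mul_iff hm']
    exact ⟨(hc.mul hm').add_even (even_two_mul j), hj.2⟩
  have hmem (c : ℕ) (j : ℤ) (hj : Odd j) (hk : IsCoprime ((c : ℤ) * m + 2 * j) m) :
      x ^ ((c : ℤ) * m + 2 * j) ∈ (fun s => x ^ (c * m) * s) '' atom1 (x ^ 2) := by
    refine ⟨(x ^ 2) ^ j, (mem_atom1_iff _ _).mpr ⟨j, ?_, rfl⟩, htrans c j⟩
    rw [hx2, Int.isCoprime_two_pow_mul_iff (by omega)]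
    exact ⟨hj, (Int.isCoprime_mul_add_two_mul_iff hm' c j).mp hk⟩
  ext y
  constructor
  · intro hy
    obtain ⟨k, hk, rfl⟩ := (mem_atom1_iff _ _).mp hy
    rw [hx, Int.isCoprime_two_pow_mul_iff (by omega)] at hk
    obtain ⟨hkodd, hkm⟩ := hk
    obtain ⟨j, hj⟩ := (hkodd.sub_odd hm').two_dvd
    rcases Int.even_or_odd j with hje | hjo
    · right
      have hk3 : k = (3 : ℕ) * (m : ℤ) + 2 * (j - m) := by push_cast; linarith
      rw [hk3] at hkm ⊢
      exact hmem 3 _ (hje.sub_odd hm') hkm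
    · left
      have hk1 : k = (1 : ℕ) * (m : ℤ) + 2 * j := by push_cast; linarith
      rw [hk1] at hkm ⊢
      simpa only [one_mul] using hmem 1 j hjo hkm
  · rintro (⟨s, hs, rfl⟩ | ⟨s, hs, rfl⟩) <;> obtain ⟨j, hj, rfl⟩ := (mem_atom1_iff _ _).mp hs
    · simpa only [one_mul] using hcop 1 (by decide) j hj
    · exact hcop 3 (by decide) j hj
end
end

section
/- Let Γ be a finite group and let x ∈ Γ have order n = 4m with m odd. Then x^m·[x⁴] = ⟦x⟧ if m ≡ 1 (mod 4), and x^m·[x⁴] = ⟦x⁻¹⟧ if m ≡ 3 (mod 4). -/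
noncomputable section

/-- `⟦x⟧ = {x^k : 1 ≤ k ≤ ord(x)−1, gcd(k, ord(x)) = 1, k ≡ 1 (mod 4)}`. -/
def bracket4 {Γ : Type*} [Group Γ] (x : Γ) : Set Γ :=
  {y | ∃ k : ℕ, 1 ≤ k ∧ k ≤ orderOf x - 1 ∧ Nat.gcd k (orderOf x) = 1 ∧ k % 4 = 1 ∧ y = x ^ k}

theorem mem_atom1_iff_exists_zpow {Γ : Type*} [Group Γ] {x y : Γ} :
    y ∈ atom1 x ↔ ∃ j : ℤ, IsCoprime j (orderOf x) ∧ y = x ^ j := by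
  constructor
  · intro h
    have h : Subgroup.zpowers y = Subgroup.zpowers x := h
    obtain ⟨j, hj⟩ := Subgroup.mem_zpowers_iff.1 (h ▸ Subgroup.mem_zpowers y)
    obtain ⟨i, hi⟩ := Subgroup.mem_zpowers_iff.1 (h.symm ▸ Subgroup.mem_zpowers x)
    have h1 : x ^ (1 - j * i) = 1 := by
      rw [zpow_sub, zpow_one, zpow_mul, hj, hi, mul_inv_cancel]
    obtain ⟨c, hc⟩ := orderOf_dvd_iff_zpow_eq_one.2 h1
    exact ⟨j, ⟨i, c, by linear_combination -hc⟩, hj.symm⟩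
  · rintro ⟨j, ⟨a, b, hab⟩, rfl⟩
    refine le_antisymm (Subgroup.zpowers_le.2 ⟨j, rfl⟩) (Subgroup.zpowers_le.2 ⟨a, ?_⟩)
    have hx : x ^ (a * j + b * orderOf x) = x := by rw [hab, zpow_one]
    rw [zpow_add, mul_comm b, zpow_mul x (orderOf x : ℤ), zpow_natCast, pow_orderOf_eq_one,
      one_zpow, mul_one, mul_comm a, zpow_mul] at hx
    exact hx

theorem mem_bracket4_iff_exists_zpow {Γ : Type*} [Group Γ] {x y : Γ}
    (h4 : 4 ∣ orderOf x) (hpos : 0 < orderOf x) :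
    y ∈ bracket4 x ↔ ∃ k : ℤ, IsCoprime k (orderOf x) ∧ k % 4 = 1 ∧ y = x ^ k := by
  constructor
  · rintro ⟨k, -, -, hk, hk4, rfl⟩
    exact ⟨k, Nat.isCoprime_iff_coprime.2 hk, by omega, (zpow_natCast x k).symm⟩
  · rintro ⟨k, hk, hk4, rfl⟩
    have hlt : k % orderOf x < orderOf x := Int.emod_lt_of_pos k (by exact_mod_cast hpos)
    obtain ⟨l, hl⟩ := Int.eq_ofNat_of_zero_le
      (Int.emod_nonneg k (b := (orderOf x : ℤ)) (by exact_mod_cast hpos.ne'))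
    have hmod : k % orderOf x % 4 = k % 4 :=
      Int.emod_emod_of_dvd k (by exact_mod_cast h4)
    rw [hl] at hlt hmod
    refine ⟨l, by omega, by omega, Nat.isCoprime_iff_coprime.1 ?_, by omega, ?_⟩
    · rw [← hl, Int.emod_def, sub_eq_add_neg, ← mul_neg]
      exact hk.add_mul_left_left _
    · rw [← zpow_mod_orderOf, hl, zpow_natCast]

theorem mem_translate_atom1_pow_four_iff {Γ : Type*} [Group Γ] {x y : Γ} {m : ℕ}
    (hord : orderOf x = 4 * m) (hm : Odd m) :
    y ∈ (fun s => x ^ m * s) '' atom1 (x ^ 4) ↔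
      ∃ k : ℤ, IsCoprime k (orderOf x) ∧ k % 4 = m % 4 ∧ y = x ^ k := by
  have hord4 : orderOf (x ^ 4) = m := by
    rw [orderOf_pow_of_dvd (by norm_num) (hord ▸ dvd_mul_right 4 m), hord]
    omega
  have h2m : IsCoprime (2 : ℤ) m :=
    Nat.isCoprime_iff_coprime.2 (Nat.coprime_two_left.2 hm)
  have h4m : IsCoprime (4 : ℤ) m := by simpa using h2m.mul_left h2m
  have hcast : (orderOf x : ℤ) = 4 * m := by exact_mod_cast hord
  have hpow (j : ℤ) : x ^ m * (x ^ 4) ^ j = x ^ (m + 4 * j) := by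
    rw [zpow_add, zpow_mul, zpow_natCast, zpow_ofNat]
  rw [hcast]
  constructor
  · rintro ⟨s, hs, rfl⟩
    obtain ⟨j, hj, rfl⟩ := mem_atom1_iff_exists_zpow.1 hs
    rw [hord4] at hj
    refine ⟨m + 4 * j, IsCoprime.mul_right ?_ ?_, by omega, hpow j⟩
    · exact h4m.symm.add_mul_left_left j
    · simpa [add_comm] using (h4m.mul_left hj).add_mul_left_left 1
  · rintro ⟨k, hk, hk4, rfl⟩
    obtain ⟨j, rfl⟩ : ∃ j : ℤ, k = m + 4 * j := ⟨(k - m) / 4, by omega⟩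
    refine ⟨(x ^ 4) ^ j, mem_atom1_iff_exists_zpow.2 ⟨j, ?_, rfl⟩, hpow j⟩
    rw [hord4]
    have h : IsCoprime (4 * j + m * 1) (m : ℤ) := by
      simpa [add_comm] using hk.of_mul_right_right
    exact h.of_add_mul_left_left.of_mul_left_right

/-- If `x` has order `n = 4m` with `m` odd, then `x^m·[x⁴] = ⟦x⟧` if `m ≡ 1 (mod 4)`,
and `x^m·[x⁴] = ⟦x⁻¹⟧` if `m ≡ 3 (mod 4)`. -/
theorem translate_atom1_pow_four
    (Γ : Type*) [Group Γ] [Fintype Γ] (x : Γ) (m : ℕ)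
    (hord : orderOf x = 4 * m) (hm : Odd m) :
    (m % 4 = 1 → (fun s => x ^ m * s) '' atom1 (x ^ 4) = bracket4 x)
      ∧ (m % 4 = 3 → (fun s => x ^ m * s) '' atom1 (x ^ 4) = bracket4 x⁻¹) := by
  have h4 : 4 ∣ orderOf x := hord ▸ dvd_mul_right 4 m
  have hpos : 0 < orderOf x := orderOf_pos x
  refine ⟨fun h => ?_, fun h => ?_⟩ <;> ext y
  · have hmod : (m : ℤ) % 4 = 1 := by omega
    rw [mem_translate_atom1_pow_four_iff hord hm, mem_bracket4_iff_exists_zpow h4 hpos, hmod]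
  · rw [mem_translate_atom1_pow_four_iff hord hm, mem_bracket4_iff_exists_zpow
      ((orderOf_inv x).symm ▸ h4) ((orderOf_inv x).symm ▸ hpos), orderOf_inv]
    constructor <;> rintro ⟨k, hk, hk4, rfl⟩ <;>
      exact ⟨-k, hk.neg_left, by omega, by simp⟩
end
end

section
/- Let Γ be a finite group and let x ∈ Γ have order n = 2^t · m with m odd and t ≥ 2. If x₁, x₂, …, x_k ∈ Cl(x) are such that S¹_x is the disjoint union of [x₁], [x₂], …, [x_k], then S¹_{x²} = [x₁²] ∪ [x₂²] ∪ … ∪ [x_k²]. -/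
noncomputable section

/-- `S¹_x = ∪_{s ∈ Cl(x)} [s]`. -/
def S1 {Γ : Type*} [Group Γ] (x : Γ) : Set Γ :=
  ⋃ s ∈ {y | IsConj x y}, atom1 s

theorem zpowers_pow_le_of_mem_zpowers {Γ : Type*} [Group Γ] {a b : Γ}
    (h : a ∈ Subgroup.zpowers b) (n : ℕ) :
    Subgroup.zpowers (a ^ n) ≤ Subgroup.zpowers (b ^ n) := by
  obtain ⟨j, rfl⟩ := Subgroup.mem_zpowers_iff.mp h
  rw [Subgroup.zpowers_le, Subgroup.mem_zpowers_iff]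
  exact ⟨j, by rw [← zpow_natCast, ← zpow_natCast, zpow_comm]⟩

theorem zpowers_pow_eq_of_zpowers_eq {Γ : Type*} [Group Γ] {a b : Γ}
    (h : Subgroup.zpowers a = Subgroup.zpowers b) (n : ℕ) :
    Subgroup.zpowers (a ^ n) = Subgroup.zpowers (b ^ n) :=
  le_antisymm (zpowers_pow_le_of_mem_zpowers (h ▸ Subgroup.mem_zpowers a) n)
    (zpowers_pow_le_of_mem_zpowers (h ▸ Subgroup.mem_zpowers b) n)

/-- If `x` has order `2^t·m` with `m` odd, `t ≥ 2`, and `S¹_x` is the disjoint union of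
`[x₁], …, [x_k]` with `x₁, …, x_k ∈ Cl(x)`, then `S¹_{x²} = [x₁²] ∪ … ∪ [x_k²]`. -/
theorem S1_sq_eq_union
    (Γ : Type*) [Group Γ] [Fintype Γ] (x : Γ) (t m : ℕ)
    (hord : orderOf x = 2 ^ t * m) (hm : Odd m) (ht : 2 ≤ t)
    (k : ℕ) (xs : Fin k → Γ)
    (hconj : ∀ i, IsConj x (xs i))
    (hunion : S1 x = ⋃ i, atom1 (xs i))
    (hdisj : ∀ i j, i ≠ j → Disjoint (atom1 (xs i)) (atom1 (xs j))) :
    S1 (x ^ 2) = ⋃ i, atom1 ((xs i) ^ 2) := by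
  apply Set.Subset.antisymm
  · intro y hy
    obtain ⟨s, hs, hys⟩ := Set.mem_iUnion₂.mp hy
    obtain ⟨g, rfl⟩ := isConj_iff.mp hs
    have hg : g * x * g⁻¹ ∈ S1 x :=
      Set.mem_iUnion₂.mpr ⟨g * x * g⁻¹, isConj_iff.mpr ⟨g, rfl⟩, rfl⟩
    rw [hunion] at hg
    obtain ⟨i, hi⟩ := Set.mem_iUnion.mp hg
    have hsq := zpowers_pow_eq_of_zpowers_eq hi 2
    rw [conj_pow] at hsq
    exact Set.mem_iUnion.mpr ⟨i, Eq.trans hys hsq⟩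
  · exact Set.iUnion_subset fun i y hy => Set.mem_iUnion₂.mpr ⟨xs i ^ 2, (hconj i).pow 2, hy⟩
end
end

section
/- Let Γ be a finite group and let y ∈ Γ(4) have order n = 4m with m odd. If y₁, y₂, …, y_k ∈ Cl(y) are such that S⁴_y is the disjoint union of ⟦y₁⟧, ⟦y₂⟧, …, ⟦y_k⟧, then S¹_{y⁴} = [y₁⁴] ∪ [y₂⁴] ∪ … ∪ [y_k⁴]. -/
noncomputable section

/-- `S⁴_y = ∪_{s ∈ Cl(y)} ⟦s⟧`. -/
def S4 {Γ : Type*} [Group Γ] (y : Γ) : Set Γ :=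
  ⋃ s ∈ {z | IsConj y z}, bracket4 s

theorem mem_bracket4_self {Γ : Type*} [Group Γ] {x : Γ} (hx : 2 ≤ orderOf x) :
    x ∈ bracket4 x :=
  ⟨1, le_rfl, by omega, Nat.gcd_one_left _, rfl, (pow_one x).symm⟩

theorem zpowers_pow_eq_of_mem_bracket4 {Γ : Type*} [Group Γ] {x t : Γ} (ht : t ∈ bracket4 x)
    (n : ℕ) : Subgroup.zpowers (t ^ n) = Subgroup.zpowers (x ^ n) := by
  obtain ⟨k, -, -, hk, -, rfl⟩ := ht
  obtain ⟨l, hl⟩ := exists_pow_eq_self_of_coprime hk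
  refine le_antisymm (Subgroup.zpowers_le.mpr ?_) (Subgroup.zpowers_le.mpr ?_)
  · rw [pow_right_comm]
    exact Subgroup.npow_mem_zpowers _ _
  · have hxn : x ^ n = ((x ^ k) ^ n) ^ l := by rw [pow_right_comm _ n l, hl]
    exact hxn ▸ Subgroup.npow_mem_zpowers ((x ^ k) ^ n) l

/-- If `y ∈ Γ(4)` has order `4m` with `m` odd and `S⁴_y` is the disjoint union of
`⟦y₁⟧, …, ⟦y_k⟧` with `y₁, …, y_k ∈ Cl(y)`, then `S¹_{y⁴} = [y₁⁴] ∪ … ∪ [y_k⁴]`. -/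
theorem S1_pow_four_eq_union
    (Γ : Type*) [Group Γ] [Fintype Γ] (y : Γ) (m : ℕ)
    (hord : orderOf y = 4 * m) (hm : Odd m)
    (k : ℕ) (ys : Fin k → Γ)
    (hconj : ∀ i, IsConj y (ys i))
    (hunion : S4 y = ⋃ i, bracket4 (ys i))
    (hdisj : ∀ i j, i ≠ j → Disjoint (bracket4 (ys i)) (bracket4 (ys j))) :
    S1 (y ^ 4) = ⋃ i, atom1 ((ys i) ^ 4) := by
  apply Set.Subset.antisymm
  · intro z hz
    simp only [S1, Set.mem_iUnion, Set.mem_ofPred_eq] at hz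
    obtain ⟨s, hs, hz⟩ := hz
    obtain ⟨g, rfl⟩ := isConj_iff.mp hs
    rw [← conj_pow] at hz
    have hy : IsConj y (g * y * g⁻¹) := isConj_iff.mpr ⟨g, rfl⟩
    have hpos := hm.pos
    have hmem : g * y * g⁻¹ ∈ S4 y := by
      refine Set.mem_biUnion hy (mem_bracket4_self ?_)
      rw [← MulAut.conj_apply, MulEquiv.orderOf_eq, hord]
      omega
    rw [hunion, Set.mem_iUnion] at hmem
    obtain ⟨i, hi⟩ := hmem
    exact Set.mem_iUnion.mpr ⟨i, hz.trans (zpowers_pow_eq_of_mem_bracket4 hi 4)⟩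
  · exact Set.iUnion_subset fun i => Set.subset_biUnion_of_mem (u := atom1) ((hconj i).pow 4)
end
end

section
/- Let Γ be a finite group and let y ∈ Γ(4) have order n = 2^t · m with m odd and t ≥ 2. If y₁, y₂, …, y_k ∈ Cl(y) are such that S⁴_y is the disjoint union of ⟦y₁⟧, ⟦y₂⟧, …, ⟦y_k⟧, then S¹_{y²} = [y₁²] ∪ [y₂²] ∪ … ∪ [y_k²]. -/
noncomputable section

theorem zpowers_pow_eq_of_coprime {G : Type*} [Group G] {x : G} {k : ℕ}
    (h : k.Coprime (orderOf x)) : Subgroup.zpowers (x ^ k) = Subgroup.zpowers x := by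
  obtain ⟨l, hl⟩ := exists_pow_eq_self_of_coprime h
  refine le_antisymm ?_ ?_
  · exact Subgroup.zpowers_le.2 (Subgroup.npow_mem_zpowers x k)
  · exact Subgroup.zpowers_le.2 (Subgroup.mem_zpowers_iff.2 ⟨l, by simpa using hl⟩)

theorem zpowers_sq_eq_of_mem_bracket4 {G : Type*} [Group G] {x z : G} (h : z ∈ bracket4 x) :
    Subgroup.zpowers (z ^ 2) = Subgroup.zpowers (x ^ 2) := by
  obtain ⟨k, -, -, hk, -, rfl⟩ := h
  rw [pow_right_comm]
  exact zpowers_pow_eq_of_coprime (Nat.Coprime.coprime_dvd_right (orderOf_pow_dvd 2) hk)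

theorem self_mem_bracket4 {G : Type*} [Group G] {x : G} (h : 2 ≤ orderOf x) :
    x ∈ bracket4 x :=
  ⟨1, le_rfl, by omega, Nat.gcd_one_left _, rfl, (pow_one x).symm⟩

/-- If `y ∈ Γ(4)` has order `2^t·m` with `m` odd and `t ≥ 2`, and `S⁴_y` is the disjoint union
of `⟦y₁⟧, …, ⟦y_k⟧` with `y₁, …, y_k ∈ Cl(y)`, then `S¹_{y²} = [y₁²] ∪ … ∪ [y_k²]`. -/
theorem S1_sq_eq_union_of_S4
    (Γ : Type*) [Group Γ] [Fintype Γ] (y : Γ) (t m : ℕ)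
    (hord : orderOf y = 2 ^ t * m) (hm : Odd m) (ht : 2 ≤ t)
    (k : ℕ) (ys : Fin k → Γ)
    (hconj : ∀ i, IsConj y (ys i))
    (hunion : S4 y = ⋃ i, bracket4 (ys i))
    (hdisj : ∀ i j, i ≠ j → Disjoint (bracket4 (ys i)) (bracket4 (ys j))) :
    S1 (y ^ 2) = ⋃ i, atom1 ((ys i) ^ 2) := by
  have two_le : 2 ≤ orderOf y := by
    have h4 : 2 ^ 2 ≤ 2 ^ t := Nat.pow_le_pow_right (by norm_num) ht
    have := Nat.le_mul_of_pos_right (2 ^ t) hm.pos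
    omega
  ext w
  simp only [S1, Set.mem_iUnion, Set.mem_ofPred_eq, exists_prop]
  constructor
  · rintro ⟨s, hs, hw⟩
    obtain ⟨g, rfl⟩ := isConj_iff.1 hs
    rw [← conj_pow] at hw
    set z := g * y * g⁻¹
    have hyz : IsConj y z := isConj_iff.2 ⟨g, rfl⟩
    have hord_z : orderOf y = orderOf z := ((MulAut.conj g).orderOf_eq y).symm
    have hmem : z ∈ S4 y :=
      Set.mem_biUnion hyz (self_mem_bracket4 (hord_z ▸ two_le))
    rw [hunion, Set.mem_iUnion] at hmem
    obtain ⟨i, hi⟩ := hmem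
    exact ⟨i, hw.trans (zpowers_sq_eq_of_mem_bracket4 hi)⟩
  · rintro ⟨i, hw⟩
    exact ⟨ys i ^ 2, (hconj i).pow 2, hw⟩
end
end
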